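/- arXiv:2011.07907 — 2 statements merged into one kernel-verified Lean document; each statement's English description precedes it below -/
import Mathlib

section
/- Assume ∫_0^∞ φ(r) dr < ∞. Then for every x ∈ ℝ^d the limit c(x) = lim_{t→∞} (1/t) ∫_s^{s+t} du ∫_{s−t}^u c(x,u,v) dv exists uniformly in s ≥ 0, does not depend on s, and equals c(x) = ∫_{−∞}^0 c(x,0,r) dr. Moreover, for all s, t ≥ 0, | t·c(x) − ∫_s^{s+t} du ∫_{s−t}^u c(x,u,v) dv | ≤ 2L² ∫_0^t du ∫_{t+u}^∞ φ(r) dr. -/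
open MeasureTheory ProbabilityTheory
open scoped RealInnerProductSpace

noncomputable section

/-- The φ-dependence coefficient between two sub-σ-algebras:
`φ(𝒢,ℋ) = sup{ |P(Γ∩Δ)/P(Γ) − P(Δ)| : Γ ∈ 𝒢, P(Γ) ≠ 0, Δ ∈ ℋ }`. -/
def phiDep {Ω : Type*} {mΩ : MeasurableSpace Ω} (P : Measure Ω) (G H : MeasurableSpace Ω) : ℝ :=
  sSup {r : ℝ | ∃ Γ Δ : Set Ω, MeasurableSet[G] Γ ∧ MeasurableSet[H] Δ ∧ P Γ ≠ 0 ∧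
    r = |(P (Γ ∩ Δ)).toReal / (P Γ).toReal - (P Δ).toReal|}

/-- `ℱ_{-∞,t} = ⋃_{s ≤ t} ℱ_{s,t}`. -/
def Fpast {Ω : Type*} (F : ℝ → ℝ → MeasurableSpace Ω) (t : ℝ) : MeasurableSpace Ω :=
  ⨆ s : ℝ, ⨆ _ : s ≤ t, F s t

/-- `ℱ_{t,∞} = ⋃_{v ≥ t} ℱ_{t,v}`. -/
def Ffut {Ω : Type*} (F : ℝ → ℝ → MeasurableSpace Ω) (t : ℝ) : MeasurableSpace Ω :=
  ⨆ v : ℝ, ⨆ _ : t ≤ v, F t v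

/-- The mixing coefficient `φ(u) = sup_t φ(ℱ_{−∞,t}, ℱ_{t+u,∞})`. -/
def phiMix {Ω : Type*} {mΩ : MeasurableSpace Ω} (P : Measure Ω)
    (F : ℝ → ℝ → MeasurableSpace Ω) (u : ℝ) : ℝ :=
  ⨆ t : ℝ, phiDep P (Fpast F t) (Ffut F (t + u))


lemma phiDep_bdd {Ω : Type*} {mΩ : MeasurableSpace Ω} (P : Measure Ω) [IsProbabilityMeasure P]
    (G H : MeasurableSpace Ω) :
    ∀ r ∈ {r : ℝ | ∃ Γ Δ : Set Ω, MeasurableSet[G] Γ ∧ MeasurableSet[H] Δ ∧ P Γ ≠ 0 ∧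
    r = |(P (Γ ∩ Δ)).toReal / (P Γ).toReal - (P Δ).toReal|}, r ≤ 1 := by
  rintro r ⟨Γ, Δ, -, -, h0, rfl⟩
  have h1 : (P Δ).toReal ≤ 1 := measureReal_le_one
  have h2 : (P (Γ ∩ Δ)).toReal / (P Γ).toReal ≤ 1 :=
    div_le_one_of_le₀ (ENNReal.toReal_mono (measure_ne_top _ _)
      (measure_mono Set.inter_subset_left)) ENNReal.toReal_nonneg
  have h3 : 0 ≤ (P (Γ ∩ Δ)).toReal / (P Γ).toReal := by positivity
  have h4 : 0 ≤ (P Δ).toReal := ENNReal.toReal_nonneg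
  rw [abs_le]; constructor <;> linarith

lemma phiDep_le_one {Ω : Type*} {mΩ : MeasurableSpace Ω} (P : Measure Ω) [IsProbabilityMeasure P]
    (G H : MeasurableSpace Ω) : phiDep P G H ≤ 1 :=
  Real.sSup_le (phiDep_bdd P G H) zero_le_one

lemma phiDep_nonneg {Ω : Type*} {mΩ : MeasurableSpace Ω} (P : Measure Ω)
    (G H : MeasurableSpace Ω) : 0 ≤ phiDep P G H := by
  apply Real.sSup_nonneg
  rintro r ⟨Γ, Δ, -, -, h0, rfl⟩
  positivity

lemma phiMix_nonneg {Ω : Type*} {mΩ : MeasurableSpace Ω} (P : Measure Ω)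
    (F : ℝ → ℝ → MeasurableSpace Ω) (u : ℝ) : 0 ≤ phiMix P F u :=
  Real.iSup_nonneg fun _ => phiDep_nonneg _ _ _

lemma phiDep_le_phiMix {Ω : Type*} {mΩ : MeasurableSpace Ω} (P : Measure Ω)
    [IsProbabilityMeasure P] (F : ℝ → ℝ → MeasurableSpace Ω) (t u : ℝ) :
    phiDep P (Fpast F t) (Ffut F (t + u)) ≤ phiMix P F u :=
  le_ciSup (f := fun t : ℝ => phiDep P (Fpast F t) (Ffut F (t + u)))
    ⟨1, by rintro _ ⟨t, rfl⟩; exact phiDep_le_one _ _ _⟩ t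

lemma phi_set {Ω : Type*} {G H mΩ : MeasurableSpace Ω} (P : Measure Ω) [IsProbabilityMeasure P]
    {Γ Δ : Set Ω} (hΓ : MeasurableSet[G] Γ) (hΔ : MeasurableSet[H] Δ) :
    |P.real (Γ ∩ Δ) - P.real Γ * P.real Δ| ≤ phiDep P G H * P.real Γ := by
  by_cases h0 : P Γ = 0
  · have : P (Γ ∩ Δ) = 0 := measure_mono_null Set.inter_subset_left h0
    simp [Measure.real, h0, this]
  · have hpos : 0 < P.real Γ := ENNReal.toReal_pos h0 (measure_ne_top _ _)
    have h : |P.real (Γ ∩ Δ) / P.real Γ - P.real Δ| ≤ phiDep P G H :=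
      le_csSup ⟨1, phiDep_bdd P G H⟩ ⟨Γ, Δ, hΓ, hΔ, h0, rfl⟩
    have e : P.real (Γ ∩ Δ) - P.real Γ * P.real Δ
        = (P.real (Γ ∩ Δ) / P.real Γ - P.real Δ) * P.real Γ := by field_simp
    rw [e, abs_mul, abs_of_pos hpos]
    gcongr

/-- scalar covariance bound on a set -/
lemma phi_scalar {Ω : Type*} {G H mΩ : MeasurableSpace Ω} (P : Measure Ω) [IsProbabilityMeasure P]
    (hG : G ≤ mΩ) (hH : H ≤ mΩ) {Γ : Set Ω} (hΓ : MeasurableSet[G] Γ)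
    (g : Ω → ℝ) (hg : Measurable[H] g) (M : ℝ) (hM : ∀ ω, |g ω| ≤ M) :
    |∫ ω in Γ, g ω ∂P - P.real Γ * ∫ ω, g ω ∂P| ≤ 2 * M * phiDep P G H * P.real Γ := by
  have hgm : Measurable g := hg.mono hH le_rfl
  have hM0 : 0 ≤ M := by
    obtain ⟨ω⟩ : Nonempty Ω := P.nonempty_of_neZero
    exact (abs_nonneg _).trans (hM ω)
  have hgi : Integrable g P := Integrable.of_bound hgm.aestronglyMeasurable M
    (Filter.Eventually.of_forall hM)
  have hfi : Integrable (fun ω => g ω + M) P := hgi.add (integrable_const M)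
  have hf0 : ∀ ω, 0 ≤ g ω + M := fun ω => by linarith [(abs_le.1 (hM ω)).1]
  have hf1 : ∀ ω, g ω + M ≤ 2 * M := fun ω => by linarith [(abs_le.1 (hM ω)).2]
  have e1 := hfi.integral_eq_integral_Ioc_meas_le (Filter.Eventually.of_forall hf0)
    (Filter.Eventually.of_forall hf1)
  have e2 := (hfi.restrict (s := Γ)).integral_eq_integral_Ioc_meas_le
    (Filter.Eventually.of_forall hf0) (Filter.Eventually.of_forall hf1)
  have hms : ∀ t, MeasurableSet {a | t ≤ g a + M} := fun t =>
    measurableSet_le measurable_const (hgm.add_const M)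
  have hmsH : ∀ t, MeasurableSet[H] {a | t ≤ g a + M} := fun t =>
    (hg.add_const M) (measurableSet_Ici (a := t))
  have anti : ∀ (Q : Measure Ω) [IsFiniteMeasure Q],
      IntegrableOn (fun t => Q.real {a | t ≤ g a + M}) (Set.Ioc 0 (2*M)) := by
    intro Q _
    have : Antitone (fun t => Q.real {a | t ≤ g a + M}) := fun a b hab =>
      measureReal_mono (fun ω (hω : b ≤ _) => hab.trans hω)
    exact (this.locallyIntegrable.integrableOn_isCompact isCompact_Icc).mono_set
      Set.Ioc_subset_Icc_self
  have e3 : ∫ ω in Γ, g ω ∂P - P.real Γ * ∫ ω, g ω ∂P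
      = ∫ t in Set.Ioc 0 (2*M), ((P.restrict Γ).real {a | t ≤ g a + M}
          - P.real Γ * P.real {a | t ≤ g a + M}) := by
    rw [integral_sub (anti _) ((anti P).const_mul _), integral_const_mul, ← e1, ← e2,
      integral_add hgi (integrable_const M), integral_add hgi.restrict (integrable_const M)]
    simp
    ring
  rw [e3]
  have := norm_setIntegral_le_of_norm_le_const (μ := volume) (s := Set.Ioc 0 (2*M))
    (f := fun t => ((P.restrict Γ).real {a | t ≤ g a + M}
          - P.real Γ * P.real {a | t ≤ g a + M})) (C := phiDep P G H * P.real Γ)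
    measure_Ioc_lt_top (by
      intro t _
      rw [measureReal_restrict_apply (hms t), Set.inter_comm]
      exact phi_set P hΓ (hmsH t))
  rw [Real.norm_eq_abs] at this
  refine this.trans (le_of_eq ?_)
  rw [Real.volume_real_Ioc_of_le (by linarith)]
  ring

/-- operator version on a set -/
lemma phi_op {Ω : Type*} {G H mΩ : MeasurableSpace Ω} (P : Measure Ω) [IsProbabilityMeasure P]
    {E : Type*} [NormedAddCommGroup E] [InnerProductSpace ℝ E] [FiniteDimensional ℝ E]
    [MeasurableSpace E] [BorelSpace E]
    (hG : G ≤ mΩ) (hH : H ≤ mΩ) {Γ : Set Ω} (hΓ : MeasurableSet[G] Γ)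
    (a : Ω → E) (ha : Measurable[H] a) (M : ℝ) (hM : ∀ ω, ‖a ω‖ ≤ M) :
    ‖∫ ω in Γ, a ω ∂P - P.real Γ • ∫ ω, a ω ∂P‖ ≤ 2 * M * phiDep P G H * P.real Γ := by
  have ham : Measurable a := ha.mono hH le_rfl
  have hai : Integrable a P := Integrable.of_bound ham.aestronglyMeasurable M
    (Filter.Eventually.of_forall hM)
  have hM0 : 0 ≤ M := by
    obtain ⟨ω⟩ : Nonempty Ω := P.nonempty_of_neZero
    exact (norm_nonneg _).trans (hM ω)
  set D := ∫ ω in Γ, a ω ∂P - P.real Γ • ∫ ω, a ω ∂P with hD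
  have hb : 0 ≤ 2 * M * phiDep P G H * P.real Γ := by
    have := phiDep_nonneg P G H
    positivity
  by_cases h0 : ‖D‖ = 0
  · rw [h0]; exact hb
  have hpos : 0 < ‖D‖ := lt_of_le_of_ne (norm_nonneg _) (Ne.symm h0)
  have key := phi_scalar P hG hH hΓ (fun ω => ⟪D, a ω⟫)
    ((continuous_const.inner continuous_id).measurable.comp ha) (‖D‖ * M) (fun ω =>
      (abs_real_inner_le_norm _ _).trans (by gcongr; exact hM ω))
  rw [integral_inner hai.restrict, integral_inner hai, ← real_inner_smul_right,
    ← inner_sub_right, ← hD, real_inner_self_eq_norm_sq, abs_of_nonneg (by positivity)] at key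
  have : ‖D‖ * ‖D‖ ≤ ‖D‖ * (2 * M * phiDep P G H * P.real Γ) := by nlinarith
  exact le_of_mul_le_mul_left this hpos

/-- covariance bound for simple functions -/
lemma phi_simple {Ω : Type*} {G H mΩ : MeasurableSpace Ω} (P : Measure Ω) [IsProbabilityMeasure P]
    {E : Type*} [NormedAddCommGroup E] [InnerProductSpace ℝ E] [FiniteDimensional ℝ E]
    [MeasurableSpace E] [BorelSpace E]
    (hG : G ≤ mΩ) (hH : H ≤ mΩ)
    (A : Ω → E →L[ℝ] E) (hA : Measurable[H] A) (M : ℝ) (hM : ∀ ω, ‖A ω‖ ≤ M)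
    (b : @SimpleFunc Ω G E) :
    ‖∫ ω, A ω (b ω) ∂P - (∫ ω, A ω ∂P) (∫ ω, b ω ∂P)‖
      ≤ 2 * M * phiDep P G H * ∫ ω, ‖b ω‖ ∂P := by
  have hAm : Measurable A := hA.mono hH le_rfl
  have hAi : Integrable A P := Integrable.of_bound hAm.aestronglyMeasurable M
    (Filter.Eventually.of_forall hM)
  have hbs : ∀ b : @SimpleFunc Ω G E, AEStronglyMeasurable b P := fun b =>
    ((@SimpleFunc.stronglyMeasurable _ _ G _ b).mono hG).aestronglyMeasurable
  have hbi : ∀ b : @SimpleFunc Ω G E, Integrable b P := fun b => by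
    obtain ⟨C, hC⟩ := @SimpleFunc.exists_forall_norm_le _ _ G _ b
    exact Integrable.of_bound (hbs b) C (Filter.Eventually.of_forall hC)
  have hAb : ∀ b : @SimpleFunc Ω G E, Integrable (fun ω => A ω (b ω)) P := fun b => by
    refine Integrable.mono' ((hbi b).norm.const_mul M) ?_ ?_
    · exact (ContinuousLinearMap.id ℝ (E →L[ℝ] E)).aestronglyMeasurable_comp₂
        hAm.aestronglyMeasurable (hbs b)
    · exact Filter.Eventually.of_forall fun ω => (A ω).le_of_opNorm_le (hM ω) _
  refine @SimpleFunc.induction Ω E G _ (fun b => ‖∫ ω, A ω (b ω) ∂P - (∫ ω, A ω ∂P) (∫ ω, b ω ∂P)‖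
      ≤ 2 * M * phiDep P G H * ∫ ω, ‖b ω‖ ∂P) ?_ ?_ b
  · intro c s hs
    have hs' := hG _ hs
    obtain ⟨f, hf⟩ : ∃ f, f = @SimpleFunc.piecewise Ω E G s hs (@SimpleFunc.const Ω E G c)
      (@SimpleFunc.const Ω E G 0) := ⟨_, rfl⟩
    rw [← hf]
    have e2 : ∀ ω, f ω = s.indicator (fun ω => c) ω := by
      intro ω
      rw [hf]
      by_cases h : ω ∈ s <;> simp [h]
    have e1 : ∀ ω, A ω (f ω) = s.indicator (fun ω => A ω c) ω := by
      intro ω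
      rw [e2]
      by_cases h : ω ∈ s <;> simp [h]
    have e3 : ∀ ω, ‖f ω‖ = s.indicator (fun ω => ‖c‖) ω := by
      intro ω
      rw [e2]
      by_cases h : ω ∈ s <;> simp [h]
    simp_rw [e1, e3, e2]
    rw [integral_indicator hs', integral_indicator hs', integral_indicator hs']
    have := phi_op P hG hH hs (fun ω => A ω c)
      ((ContinuousLinearMap.apply ℝ E c).continuous.measurable.comp hA) (M * ‖c‖)
      (fun ω => (A ω).le_of_opNorm_le (hM ω) _)
    simp only [integral_const, measureReal_restrict_apply_univ, smul_eq_mul, map_smul]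
    rw [ContinuousLinearMap.integral_apply hAi]
    refine this.trans (le_of_eq (by ring))
  · intro f g hd hf hg
    have e1 : ∀ ω, A ω ((f + g) ω) = A ω (f ω) + A ω (g ω) := fun ω => by simp
    have e2 : ∀ ω, (f + g) ω = f ω + g ω := fun ω => rfl
    have e3 : ∀ ω, ‖(f + g) ω‖ = ‖f ω‖ + ‖g ω‖ := fun ω => by
      rw [e2]
      by_cases h : f ω = 0
      · simp [h]
      · have : g ω = 0 := by
          by_contra h2
          exact Set.disjoint_left.1 hd (show ω ∈ Function.support f from h) h2
        simp [this]
    have h := norm_add_le_of_le hf hg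
    simp_rw [e1, e3, e2]
    rw [integral_add (hAb f) (hAb g), integral_add (hbi f) (hbi g),
      integral_add (hbi f).norm (hbi g).norm, map_add, mul_add]
    convert! h using 2
    abel

/-- general covariance bound -/
lemma phi_cov {Ω : Type*} {G H mΩ : MeasurableSpace Ω} (P : Measure Ω) [IsProbabilityMeasure P]
    {E : Type*} [NormedAddCommGroup E] [InnerProductSpace ℝ E] [FiniteDimensional ℝ E]
    [MeasurableSpace E] [BorelSpace E]
    (hG : G ≤ mΩ) (hH : H ≤ mΩ)
    (A : Ω → E →L[ℝ] E) (hA : Measurable[H] A) (M : ℝ) (hM : ∀ ω, ‖A ω‖ ≤ M)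
    (b : Ω → E) (hb : Measurable[G] b) (N : ℝ) (hN : ∀ ω, ‖b ω‖ ≤ N) (hb0 : ∫ ω, b ω ∂P = 0) :
    ‖∫ ω, A ω (b ω) ∂P‖ ≤ 2 * M * N * phiDep P G H := by
  obtain ⟨ω0⟩ : Nonempty Ω := P.nonempty_of_neZero
  have hM0 : 0 ≤ M := (norm_nonneg _).trans (hM ω0)
  have hN0 : 0 ≤ N := (norm_nonneg _).trans (hN ω0)
  have hAm : Measurable A := hA.mono hH le_rfl
  have hbS : StronglyMeasurable[G] b := hb.stronglyMeasurable
  obtain ⟨f, hf⟩ : ∃ f, f = hbS.approxBounded N := ⟨_, rfl⟩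
  have hfN : ∀ n ω, ‖f n ω‖ ≤ N := fun n ω => by
    rw [hf]; exact hbS.norm_approxBounded_le hN0 n ω
  have hft : ∀ ω, Filter.Tendsto (fun n => f n ω) Filter.atTop (nhds (b ω)) := fun ω => by
    rw [hf]; exact hbS.tendsto_approxBounded_of_norm_le (hN ω)
  have hbs : ∀ b : @SimpleFunc Ω G E, AEStronglyMeasurable b P := fun b =>
    ((@SimpleFunc.stronglyMeasurable _ _ G _ b).mono hG).aestronglyMeasurable
  have t1 : Filter.Tendsto (fun n => ∫ ω, f n ω ∂P) Filter.atTop (nhds 0) := by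
    rw [← hb0]
    exact tendsto_integral_of_dominated_convergence (fun _ => N) (fun n => hbs _)
      (integrable_const N) (fun n => Filter.Eventually.of_forall (hfN n))
      (Filter.Eventually.of_forall hft)
  have t2 : Filter.Tendsto (fun n => ∫ ω, A ω (f n ω) ∂P) Filter.atTop
      (nhds (∫ ω, A ω (b ω) ∂P)) := by
    refine tendsto_integral_of_dominated_convergence (fun _ => M * N) (fun n => ?_)
      (integrable_const _) (fun n => Filter.Eventually.of_forall fun ω => ?_)
      (Filter.Eventually.of_forall fun ω => ((A ω).continuous.tendsto _).comp (hft ω))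
    · exact (ContinuousLinearMap.id ℝ (E →L[ℝ] E)).aestronglyMeasurable_comp₂
        hAm.aestronglyMeasurable (hbs _)
    · exact ((A ω).le_of_opNorm_le (hM ω) _).trans (by gcongr; exact hfN n ω)
  have t3 := (t2.sub (((∫ ω, A ω ∂P).continuous.tendsto _).comp t1)).norm
  rw [map_zero, sub_zero] at t3
  refine le_of_tendsto t3 (Filter.Eventually.of_forall fun n => ?_)
  refine (phi_simple P hG hH A hA M hM (f n)).trans ?_
  have h1 : ∫ ω, ‖f n ω‖ ∂P ≤ N := by
    have := norm_integral_le_of_norm_le_const (μ := P) (f := fun ω => ‖f n ω‖) (C := N)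
      (Filter.Eventually.of_forall fun ω => by simpa using hfN n ω)
    simpa using (le_abs_self _).trans this
  have := phiDep_nonneg P G H
  calc _ ≤ 2 * M * phiDep P G H * N := by gcongr
    _ = _ := by ring

/-- measurability of the derivative in the parameter -/
lemma meas_fderiv {d : ℕ} {Y : Type*} [MeasurableSpace Y]
    (B : EuclideanSpace ℝ (Fin d) → Y → EuclideanSpace ℝ (Fin d))
    (hBmeas : ∀ x, Measurable (B x))
    (hBd : ∀ y, Differentiable ℝ fun x => B x y) (x : EuclideanSpace ℝ (Fin d)) :
    Measurable fun y => fderiv ℝ (fun x' => B x' y) x := by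
  have h1 : ∀ v, Measurable fun y => fderiv ℝ (fun x' => B x' y) x v := by
    intro v
    refine measurable_of_tendsto_metrizable
      (f := fun (n : ℕ) y => ((n : ℝ) + 1) • (B (x + ((n : ℝ) + 1)⁻¹ • v) y - B x y)) (fun n => ?_) ?_
    · exact ((hBmeas _).sub (hBmeas _)).const_smul ((n : ℝ) + 1)
    · rw [tendsto_pi_nhds]
      intro y
      have hc : Filter.Tendsto (fun n : ℕ => ((n : ℝ) + 1)) Filter.atTop Filter.atTop :=
        Filter.tendsto_atTop_add_const_right _ _ tendsto_natCast_atTop_atTop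
      refine HasFDerivAt.lim (hBd y x).hasFDerivAt v (c := fun n : ℕ => ((n : ℝ) + 1))
        (tendsto_norm_atTop_atTop.comp hc)
  let e := EuclideanSpace.basisFun (Fin d) ℝ
  have h2 : (fun y => fderiv ℝ (fun x' => B x' y) x) = fun y =>
      ∑ i, (ContinuousLinearMap.smulRightL ℝ _ _ (innerSL ℝ (e i))) (fderiv ℝ (fun x' => B x' y) x (e i)) := by
    ext1 y
    refine ContinuousLinearMap.ext fun v => ?_
    conv_lhs => rw [← e.sum_repr v, map_sum]
    rw [sum_apply]
    refine Finset.sum_congr rfl fun i _ => ?_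
    simp [e.repr_apply_apply]
  rw [h2]
  exact Finset.measurable_sum _ fun i _ =>
    (ContinuousLinearMap.continuous _).measurable.comp (h1 (e i))

lemma c_bound_analytic {E : Type*} [NormedAddCommGroup E] [NormedSpace ℝ E] [CompleteSpace E]
    (g : ℝ → E) (φ : ℝ → ℝ) (K C : ℝ) (hK : 0 ≤ K) (hφ0 : ∀ r, 0 ≤ φ r)
    (hφ : IntegrableOn φ (Set.Ioi 0)) (hgm : StronglyMeasurable g) (hgC : ∀ r, ‖g r‖ ≤ C)
    (hg : ∀ r ≤ 0, ‖g r‖ ≤ K * φ (-r)) :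
    (∀ s t : ℝ, 0 ≤ s → 0 ≤ t →
      ‖t • (∫ r in Set.Iic (0:ℝ), g r) - ∫ u in s..(s + t), ∫ v in (s - t)..u, g (v - u)‖ ≤
          K * ∫ u in (0:ℝ)..t, ∫ r in Set.Ioi (t + u), φ r) ∧
      TendstoUniformlyOn
        (fun (t : ℝ) (s : ℝ) => t⁻¹ • ∫ u in s..(s + t), ∫ v in (s - t)..u, g (v - u))
        (fun _ => ∫ r in Set.Iic (0:ℝ), g r) Filter.atTop (Set.Ici 0) := by
  have hφneg : IntegrableOn (fun r => φ (-r)) (Set.Iic 0) := by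
    rw [integrableOn_Iic_iff_integrableOn_Iio]
    have := hφ.comp_neg
    simpa using this
  have hgi : IntegrableOn g (Set.Iic 0) := by
    refine Integrable.mono' (hφneg.const_mul K) hgm.aestronglyMeasurable ?_
    exact (ae_restrict_iff' measurableSet_Iic).2 (Filter.Eventually.of_forall hg)
  have hgii : ∀ a b, IntervalIntegrable g volume a b := fun a b => by
    refine ⟨?_, ?_⟩ <;>
    exact Measure.integrableOn_of_bounded (M := C) measure_Ioc_lt_top.ne
      hgm.aestronglyMeasurable (Filter.Eventually.of_forall hgC)
  have hΦanti : AntitoneOn (fun a => ∫ r in Set.Ioi a, φ r) (Set.Ici 0) := by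
    intro a ha b hb hab
    exact setIntegral_mono_set (hφ.mono_set (Set.Ioi_subset_Ioi ha))
      (Filter.Eventually.of_forall hφ0) (Set.Ioi_subset_Ioi hab).eventuallyLE
  have hΦii : ∀ t, 0 ≤ t → IntervalIntegrable (fun u => ∫ r in Set.Ioi (t + u), φ r) volume 0 t := by
    intro t ht
    apply AntitoneOn.intervalIntegrable
    intro a ha b hb hab
    rw [Set.uIcc_of_le ht] at ha hb
    exact hΦanti (add_nonneg ht ha.1) (add_nonneg ht hb.1) (by linarith)
  have main : ∀ s t : ℝ, 0 ≤ s → 0 ≤ t →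
      ‖t • (∫ r in Set.Iic (0:ℝ), g r) - ∫ u in s..(s + t), ∫ v in (s - t)..u, g (v - u)‖ ≤
          K * ∫ u in (0:ℝ)..t, ∫ r in Set.Ioi (t + u), φ r := by
    intro s t _ ht
    have e1 : ∫ u in s..(s + t), ∫ v in (s - t)..u, g (v - u)
        = ∫ u in (0:ℝ)..t, ∫ v in (-(t + u))..0, g v := by
      have : ∀ u, ∫ v in (s - t)..u, g (v - u) = (fun w => ∫ v in (-(t + w))..0, g v) (u - s) := by
        intro u
        rw [intervalIntegral.integral_comp_sub_right (fun v => g v) u]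
        simp only [sub_self]
        congr 1
        ring
      simp_rw [this]
      rw [intervalIntegral.integral_comp_sub_right (fun w => ∫ v in (-(t + w))..0, g v) s]
      simp
    have hcont : Continuous fun w => ∫ v in (-(t + w))..0, g v := by
      have := intervalIntegral.continuous_primitive hgii 0
      have h2 : (fun w => ∫ v in (-(t + w))..0, g v)
          = fun w => - (fun b => ∫ v in (0:ℝ)..b, g v) (-(t + w)) := by
        ext w; exact intervalIntegral.integral_symm _ _
      rw [h2]
      exact (this.comp (by fun_prop : Continuous fun w : ℝ => -(t + w))).neg
    have e2 : t • (∫ r in Set.Iic (0:ℝ), g r) - ∫ u in (0:ℝ)..t, ∫ v in (-(t + u))..0, g v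
        = ∫ u in (0:ℝ)..t, ((∫ r in Set.Iic (0:ℝ), g r) - ∫ v in (-(t + u))..0, g v) := by
      rw [intervalIntegral.integral_sub intervalIntegrable_const (hcont.intervalIntegrable _ _)]
      simp
    rw [e1, e2, ← intervalIntegral.integral_const_mul]
    refine intervalIntegral.norm_integral_le_of_norm_le ht
      (Filter.Eventually.of_forall fun u hu => ?_) ((hΦii t ht).const_mul K)
    have hle : -(t + u) ≤ 0 := by linarith [hu.1]
    have hgi' := hgi.mono_set (Set.Iic_subset_Iic.2 hle)
    rw [← intervalIntegral.integral_Iic_sub_Iic hgi' hgi, sub_sub_cancel, ← integral_const_mul]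
    have e3 := integral_comp_neg_Iic (-(t + u)) (fun r => K * φ r)
    rw [neg_neg] at e3
    rw [← e3]
    refine norm_integral_le_of_norm_le
      ((hφneg.mono_set (Set.Iic_subset_Iic.2 hle)).const_mul K) ?_
    exact (ae_restrict_iff' measurableSet_Iic).2
      (Filter.Eventually.of_forall fun r hr => hg r (le_trans hr hle))
  refine ⟨main, ?_⟩
  rw [Metric.tendstoUniformlyOn_iff]
  intro ε hε
  have ht : Filter.Tendsto (fun t : ℝ => K * ∫ r in Set.Ioi t, φ r) Filter.atTop (nhds 0) := by
    simpa using (tendsto_integral_Ioi_zero (f := φ) (μ := volume) Filter.tendsto_id).const_mul K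
  filter_upwards [ht.eventually (gt_mem_nhds hε), Filter.eventually_gt_atTop 0] with t h1 h2 s hs
  refine lt_of_le_of_lt ?_ h1
  rw [dist_eq_norm]
  have h3 := main s t hs h2.le
  have h4 : ∫ u in (0:ℝ)..t, ∫ r in Set.Ioi (t + u), φ r ≤ t * ∫ r in Set.Ioi t, φ r := by
    have := intervalIntegral.integral_mono_on h2.le (hΦii t h2.le)
      (intervalIntegrable_const (c := ∫ r in Set.Ioi t, φ r))
      (fun u hu => hΦanti (Set.mem_Ici.2 h2.le) (add_nonneg h2.le hu.1) (by linarith [hu.1]))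
    simpa using this
  have e : ∀ c I : E, c - t⁻¹ • I = t⁻¹ • (t • c - I) := fun c I => by
    rw [smul_sub, inv_smul_smul₀ h2.ne']
  rw [e, norm_smul, norm_inv, Real.norm_of_nonneg h2.le]
  rw [inv_mul_le_iff₀ h2]
  refine h3.trans ((mul_le_mul_of_nonneg_left h4 hK).trans (le_of_eq (by ring)))

/-- Lemma 3.2, drift part: assuming `∫_0^∞ φ(r) dr < ∞`, the limit
`c(x) = lim_{t→∞} (1/t) ∫_s^{s+t} du ∫_{s−t}^u c(x,u,v) dv` exists uniformly in `s ≥ 0`,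
does not depend on `s`, equals `∫_{−∞}^0 c(x,0,r) dr`, and for all `s,t ≥ 0`
`|t·c(x) − ∫_s^{s+t} du ∫_{s−t}^u c(x,u,v) dv| ≤ 2L² ∫_0^t du ∫_{t+u}^∞ φ(r) dr`. -/
theorem strong_diffusion_stmt2
    {Ω : Type*} [m0 : MeasurableSpace Ω] (P : Measure Ω) [IsProbabilityMeasure P]
    {d ν : ℕ}
    -- the two-parameter family of σ-algebras ℱ_{s,t}
    (F : ℝ → ℝ → MeasurableSpace Ω)
    (hFle : ∀ s t : ℝ, F s t ≤ m0)
    (hFmono : ∀ s' s t t' : ℝ, s' ≤ s → s ≤ t → t ≤ t' → F s t ≤ F s' t')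
    -- the stationary process ξ, adapted and jointly (progressively) measurable
    (ξ : ℝ → Ω → EuclideanSpace ℝ (Fin ν))
    (hξmeas : Measurable fun p : ℝ × Ω => ξ p.1 p.2)
    (hξadapt : ∀ t : ℝ, Measurable[F t t] (ξ t))
    (hξprog : ∀ t : ℝ, Measurable[MeasurableSpace.prod inferInstance (Fpast F t)]
      fun p : Set.Iic t × Ω => ξ p.1.1 p.2)
    (hξstat : ∀ h : ℝ, Measure.map (fun ω => fun t : ℝ => ξ (t + h) ω) P =
      Measure.map (fun ω => fun t : ℝ => ξ t ω) P)
    -- the coefficient B : ℝ^d × ℝ^ν → ℝ^d and its bounds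
    (B : EuclideanSpace ℝ (Fin d) → EuclideanSpace ℝ (Fin ν) → EuclideanSpace ℝ (Fin d))
    (hBmeas : ∀ x, Measurable (B x))
    (hBsmooth : ∀ y, ContDiff ℝ 2 fun x => B x y)
    (L : ℝ) (hL : 1 ≤ L)
    (hBbd : ∀ x y, ‖B x y‖ ≤ L)
    (hB1bd : ∀ x y, ‖fderiv ℝ (fun x' => B x' y) x‖ ≤ L)
    (hB2bd : ∀ x y, ‖fderiv ℝ (fun x' => fderiv ℝ (fun z => B z y) x') x‖ ≤ L)
    -- the centering condition E B(x, ξ(s)) = 0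
    (hBzero : ∀ x s, ∫ ω, B x (ξ s ω) ∂P = 0)
    (hφint : IntegrableOn (phiMix P F) (Set.Ioi (0 : ℝ))) :
    ∀ x : EuclideanSpace ℝ (Fin d),
      -- with c(x,u,v) = E(∇_x B(x,ξ(u)) B(x,ξ(v))), the limit c(x) is given by ∫_{−∞}^0 c(x,0,r) dr, and:
      (∀ s t : ℝ, 0 ≤ s → 0 ≤ t →
        ‖t • (∫ r in Set.Iic (0:ℝ), ∫ ω, (fderiv ℝ (fun x' => B x' (ξ 0 ω)) x) (B x (ξ r ω)) ∂P) -
            ∫ u in s..(s + t), ∫ v in (s - t)..u,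
              ∫ ω, (fderiv ℝ (fun x' => B x' (ξ u ω)) x) (B x (ξ v ω)) ∂P‖ ≤
          2 * L ^ 2 * ∫ u in (0:ℝ)..t, ∫ r in Set.Ioi (t + u), phiMix P F r) ∧
      -- uniform convergence in s ∈ [0,∞) of (1/t)∫_s^{s+t}∫_{s−t}^u c(x,u,v) to c(x)
      TendstoUniformlyOn
        (fun (t : ℝ) (s : ℝ) => t⁻¹ •
          ∫ u in s..(s + t), ∫ v in (s - t)..u,
            ∫ ω, (fderiv ℝ (fun x' => B x' (ξ u ω)) x) (B x (ξ v ω)) ∂P)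
        (fun _ =>
          ∫ r in Set.Iic (0:ℝ), ∫ ω, (fderiv ℝ (fun x' => B x' (ξ 0 ω)) x) (B x (ξ r ω)) ∂P)
        Filter.atTop (Set.Ici 0) := by
  intro x
  have hAm : Measurable fun y => fderiv ℝ (fun x' => B x' y) x :=
    meas_fderiv B hBmeas (fun y => (hBsmooth y).differentiable (by norm_num)) x
  have hξt : ∀ t, Measurable (ξ t) := fun t => hξmeas.comp measurable_prodMk_left
  have hAb : Measurable fun p : EuclideanSpace ℝ (Fin ν) × EuclideanSpace ℝ (Fin ν) =>
      (fderiv ℝ (fun x' => B x' p.1) x) (B x p.2) := by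
    have h1 : StronglyMeasurable fun p : EuclideanSpace ℝ (Fin ν) × EuclideanSpace ℝ (Fin ν) =>
      fderiv ℝ (fun x' => B x' p.1) x := (hAm.comp measurable_fst).stronglyMeasurable
    have h2 : StronglyMeasurable fun p : EuclideanSpace ℝ (Fin ν) × EuclideanSpace ℝ (Fin ν) =>
      B x p.2 := ((hBmeas x).comp measurable_snd).stronglyMeasurable
    exact (isBoundedBilinearMap_apply.continuous.comp_stronglyMeasurable (h1.prodMk h2)).measurable
  set c : ℝ → ℝ → EuclideanSpace ℝ (Fin d) := fun u v =>
    ∫ ω, (fderiv ℝ (fun x' => B x' (ξ u ω)) x) (B x (ξ v ω)) ∂P with hc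
  have hstat : ∀ u v, c u v = c 0 (v - u) := by
    intro u v
    have hΨ : Measurable fun p : ℝ → EuclideanSpace ℝ (Fin ν) =>
        (fderiv ℝ (fun x' => B x' (p 0)) x) (B x (p (v - u))) :=
      hAb.comp (g := fun p : EuclideanSpace ℝ (Fin ν) × EuclideanSpace ℝ (Fin ν) =>
        (fderiv ℝ (fun x' => B x' p.1) x) (B x p.2))
        (f := fun p : ℝ → EuclideanSpace ℝ (Fin ν) => (p 0, p (v - u)))
        ((measurable_pi_apply 0).prodMk (measurable_pi_apply (v - u)))
    have m1 : Measurable fun ω => fun t : ℝ => ξ (t + u) ω :=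
      measurable_pi_lambda _ fun t => hξt _
    have m2 : Measurable fun ω => fun t : ℝ => ξ t ω :=
      measurable_pi_lambda _ fun t => hξt _
    have e1 := integral_map (μ := P) m1.aemeasurable hΨ.aestronglyMeasurable
    have e2 := integral_map (μ := P) m2.aemeasurable hΨ.aestronglyMeasurable
    rw [hξstat u, e2] at e1
    simp only [zero_add, sub_add_cancel] at e1
    exact e1.symm
  have hpast : ∀ t, Fpast F t ≤ m0 := fun t => iSup₂_le fun s _ => hFle s t
  have hfut : ∀ t, Ffut F t ≤ m0 := fun t => iSup₂_le fun s _ => hFle t s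
  have hbound : ∀ r ≤ 0, ‖c 0 r‖ ≤ 2 * L ^ 2 * phiMix P F (-r) := by
    intro r hr
    have h1 : F 0 0 ≤ Ffut F (r + -r) := by
      rw [add_neg_cancel]
      exact le_iSup₂ (f := fun (v : ℝ) (_ : (0:ℝ) ≤ v) => F 0 v) 0 le_rfl
    have h2 : F r r ≤ Fpast F r := le_iSup₂ (f := fun (s : ℝ) (_ : s ≤ r) => F s r) r le_rfl
    have key := phi_cov (G := Fpast F r) (H := Ffut F (r + -r)) P (hpast r) (hfut _)
      (fun ω => fderiv ℝ (fun x' => B x' (ξ 0 ω)) x)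
      (hAm.comp ((hξadapt 0).mono h1 le_rfl)) L (fun ω => hB1bd x _)
      (fun ω => B x (ξ r ω)) ((hBmeas x).comp ((hξadapt r).mono h2 le_rfl)) L
      (fun ω => hBbd x _) (hBzero x r)
    refine key.trans ?_
    rw [pow_two, ← mul_assoc]
    exact mul_le_mul_of_nonneg_left (phiDep_le_phiMix P F r (-r)) (by positivity)
  have hgm : StronglyMeasurable (c 0) := by
    refine StronglyMeasurable.integral_prod_right'
      (f := fun p : ℝ × Ω => (fderiv ℝ (fun x' => B x' (ξ 0 p.2)) x) (B x (ξ p.1 p.2))) ?_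
    exact (hAb.comp (((hξt 0).comp measurable_snd).prodMk hξmeas)).stronglyMeasurable
  have hgC : ∀ r, ‖c 0 r‖ ≤ L * L := by
    intro r
    have := norm_integral_le_of_norm_le_const (μ := P)
      (f := fun ω => (fderiv ℝ (fun x' => B x' (ξ 0 ω)) x) (B x (ξ r ω))) (C := L * L)
      (Filter.Eventually.of_forall fun ω =>
        (ContinuousLinearMap.le_of_opNorm_le _ (hB1bd x _) _).trans
          (by gcongr; exact hBbd x _))
    simpa using this
  have fin := c_bound_analytic (c 0) (phiMix P F) (2 * L ^ 2) (L * L) (by positivity)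
    (phiMix_nonneg P F) hφint hgm hgC hbound
  simp_rw [← hstat] at fin
  exact fin

end
end

section
/- Assume Σ_{l=0}^∞ φ(l) < ∞. Then for every t ≥ 0, every x ∈ ℝ^d and every integer M ≥ 1, E | ∫_0^t B(x,ξ(u)) du |^{2M} ≤ C₁(M) t^M, where C₁(M) = (2d)^{2M+1} (2M)! ( 2L (1 + Σ_{l=0}^∞ φ(l)) )^{2M}. -/
open MeasureTheory ProbabilityTheory
open scoped RealInnerProductSpace

noncomputable section

lemma sd_pow_ftc (f : ℝ → ℝ) (hf : Measurable f) (L : ℝ) (hb : ∀ u, |f u| ≤ L) (t : ℝ) (n : ℕ) :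
    (∫ u in (0:ℝ)..t, f u) ^ (n + 1) =
      ∫ r in (0:ℝ)..t, ((n : ℝ) + 1) * ((∫ u in (0:ℝ)..r, f u) ^ n * f r) := by
  have hint : ∀ a b : ℝ, IntervalIntegrable f volume a b := fun a b =>
    (intervalIntegrable_const (c := L)).mono_fun hf.aestronglyMeasurable
      (Filter.Eventually.of_forall fun u => by
        simpa using (hb u).trans (le_abs_self L))
  have hac : AbsolutelyContinuousOnInterval (fun x => ∫ v in (0:ℝ)..x, f v) 0 t :=
    (hint 0 t).absolutelyContinuousOnInterval_intervalIntegral (by simp)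
  have hpow : ∀ k : ℕ, AbsolutelyContinuousOnInterval
      (fun x => (∫ v in (0:ℝ)..x, f v) ^ (k + 1)) 0 t := by
    intro k
    induction k with
    | zero => simpa using hac
    | succ k ih =>
      have := ih.fun_mul hac
      simpa only [pow_succ _ (k + 1)] using this
  have h1 := (hpow n).integral_deriv_eq_sub
  simp only [intervalIntegral.integral_same] at h1
  rw [zero_pow (Nat.succ_ne_zero n), sub_zero] at h1
  rw [← h1]
  apply intervalIntegral.integral_congr_ae
  filter_upwards [(hint 0 t).ae_hasDerivAt_integral] with x hx hxm
  have h2 := hx (Set.uIoc_subset_uIcc hxm) 0 (by simp)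
  have h3 := h2.fun_pow (n + 1)
  rw [h3.deriv]
  push_cast
  ring_nf

lemma sd_layer {Ω : Type*} (H : MeasurableSpace Ω) [m0 : MeasurableSpace Ω] (P : Measure Ω)
    [IsProbabilityMeasure P] (hH : H ≤ m0) (Γ : Set Ω) (c : ℝ)
    (hc : ∀ Δ, MeasurableSet[H] Δ → P.real (Γ ∩ Δ) ≤ P.real Γ * P.real Δ + c * P.real Γ)
    (Z : Ω → ℝ) (hZ : Measurable[H] Z) (L : ℝ) (hL : 0 ≤ L) (hb : ∀ ω, |Z ω| ≤ L)
    (h0 : ∫ ω, Z ω ∂P = 0) :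
    ∫ ω in Γ, Z ω ∂P ≤ 2 * L * c * P.real Γ := by
  have hZm : Measurable Z := hZ.mono hH le_rfl
  have hZi : ∀ μ : Measure Ω, IsFiniteMeasure μ → Integrable Z μ := fun μ _ =>
    Integrable.of_bound hZm.aestronglyMeasurable L (Filter.Eventually.of_forall hb)
  have key : ∀ μ : Measure Ω, IsFiniteMeasure μ →
      ∫ ω, (Z ω + L) ∂μ = ∫ t in Set.Ioc 0 (2 * L), μ.real {a | t ≤ Z a + L} := fun μ _ =>
    Integrable.integral_eq_integral_Ioc_meas_le (f := fun ω => Z ω + L)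
      ((hZi μ inferInstance).add (integrable_const L))
      (Filter.Eventually.of_forall fun ω => by
        have := (abs_le.1 (hb ω)).1; simp; linarith)
      (Filter.Eventually.of_forall fun ω => by
        have := (abs_le.1 (hb ω)).2; simp; linarith)
  have mono : ∀ μ : Measure Ω, IsFiniteMeasure μ →
      IntegrableOn (fun t : ℝ => μ.real {a | t ≤ Z a + L}) (Set.Ioc 0 (2 * L)) := by
    intro μ _
    have : Antitone (fun t : ℝ => μ.real {a | t ≤ Z a + L}) := fun s t hst =>
      measureReal_mono (fun a ha => le_trans hst ha)
    exact (this.antitoneOn _).integrableOn_isCompact isCompact_Icc |>.mono_set Set.Ioc_subset_Icc_self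
  have hP := key P inferInstance
  have hR := key (P.restrict Γ) inferInstance
  rw [integral_add (hZi _ inferInstance) (integrable_const L), h0] at hP
  rw [integral_add (hZi _ inferInstance) (integrable_const L)] at hR
  simp only [integral_const, smul_eq_mul, probReal_univ, measureReal_restrict_apply_univ,
    zero_add, one_mul] at hP hR
  have hle : ∫ t in Set.Ioc 0 (2 * L), (P.restrict Γ).real {a | t ≤ Z a + L} ≤
      ∫ t in Set.Ioc 0 (2 * L), (P.real Γ * P.real {a | t ≤ Z a + L} + c * P.real Γ) := by
    refine integral_mono (mono _ inferInstance)
      (((mono P inferInstance).const_mul _).add (integrable_const _)) ?_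
    intro t
    have hm : MeasurableSet[H] {a | t ≤ Z a + L} :=
      (hZ.add_const L) measurableSet_Ici
    have := hc _ hm
    simp only [measureReal_restrict_apply (hH _ hm)]
    rwa [Set.inter_comm]
  rw [integral_add ((mono P inferInstance).const_mul _) (integrable_const _),
    integral_const_mul, ← hP] at hle
  simp only [integral_const, smul_eq_mul, measureReal_restrict_apply_univ, Real.volume_real_Ioc] at hle
  rw [max_eq_left (by linarith)] at hle
  nlinarith

lemma sd_cov {Ω : Type*} (G H : MeasurableSpace Ω) [m0 : MeasurableSpace Ω] (P : Measure Ω)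
    [IsProbabilityMeasure P] (hG : G ≤ m0) (hH : H ≤ m0) (c : ℝ)
    (hc : ∀ Γ Δ, MeasurableSet[G] Γ → MeasurableSet[H] Δ →
      P.real (Γ ∩ Δ) ≤ P.real Γ * P.real Δ + c * P.real Γ)
    (Z : Ω → ℝ) (hZ : Measurable[H] Z) (L : ℝ) (hL : 0 ≤ L) (hb : ∀ ω, |Z ω| ≤ L)
    (h0 : ∫ ω, Z ω ∂P = 0) (Y : Ω → ℝ) (hY : AEStronglyMeasurable[G] Y P)
    (hYi : Integrable Y P) :
    |∫ ω, Y ω * Z ω ∂P| ≤ 2 * L * c * ∫ ω, |Y ω| ∂P := by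
  have hup : ∀ Z : Ω → ℝ, Measurable[H] Z → (∀ ω, |Z ω| ≤ L) → ∫ ω, Z ω ∂P = 0 →
      ∀ᵐ ω ∂P, (P[Z | G]) ω ≤ 2 * L * c := by
    intro Z hZ hb h0
    have hZi : Integrable Z P := Integrable.of_bound
      (hZ.mono hH le_rfl).aestronglyMeasurable L (Filter.Eventually.of_forall hb)
    refine ae_le_of_ae_le_trim (hm := hG) (f₁ := P[Z | G]) (f₂ := fun _ => 2 * L * c) ?_
    refine ae_le_of_forall_setIntegral_le
      (integrable_condExp.trim hG stronglyMeasurable_condExp) (integrable_const _) ?_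
    intro s hs _
    rw [← setIntegral_trim hG stronglyMeasurable_condExp hs, setIntegral_condExp hG hZi hs]
    rw [← setIntegral_trim hG stronglyMeasurable_const hs]
    refine (sd_layer H P hH s c (fun Δ hΔ => hc s Δ hs hΔ) Z hZ L hL hb h0).trans ?_
    simp [mul_comm]
  have hZi : Integrable Z P := Integrable.of_bound
      (hZ.mono hH le_rfl).aestronglyMeasurable L (Filter.Eventually.of_forall hb)
  have h1 := hup Z hZ hb h0
  have h2 := hup (-Z) hZ.neg (fun ω => by simpa using hb ω) (by simp [integral_neg, h0])
  have h3 : P[-Z | G] =ᵐ[P] -P[Z | G] := condExp_neg _ _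
  have hYZ : Integrable (Y * Z) P := hYi.mul_bdd (c := L)
    (hZ.mono hH le_rfl).aestronglyMeasurable (Filter.Eventually.of_forall hb)
  have h4 := condExp_mul_of_aestronglyMeasurable_left hY hYZ hZi
  have h5 : ∫ ω, Y ω * Z ω ∂P = ∫ ω, Y ω * (P[Z | G]) ω ∂P := by
    have := integral_condExp hG (μ := P) (f := Y * Z)
    rw [integral_congr_ae h4] at this
    exact this.symm
  rw [h5, ← integral_const_mul]
  refine (abs_integral_le_integral_abs).trans ?_
  refine integral_mono_of_nonneg (Filter.Eventually.of_forall fun _ => abs_nonneg _)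
    (hYi.abs.const_mul _) ?_
  filter_upwards [h1, h2, h3] with ω a1 a2 a3
  rw [a3] at a2
  simp only [Pi.neg_apply] at a2
  rw [abs_mul, mul_comm]
  exact mul_le_mul_of_nonneg_right (abs_le.2 ⟨by linarith, a1⟩) (abs_nonneg _)

lemma sd_meas_int {Ω : Type*} [m0 : MeasurableSpace Ω] (b : ℝ → Ω → ℝ)
    (hb : Measurable fun p : ℝ × Ω => b p.1 p.2) :
    Measurable fun p : ℝ × Ω => ∫ u in (0:ℝ)..p.1, b u p.2 := by
  have h : ∀ p : ℝ × Ω, ∫ u in (0:ℝ)..p.1, b u p.2 =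
      p.1 * ∫ v in Set.Ioc (0:ℝ) 1, b (p.1 * v) p.2 := by
    intro p
    have := intervalIntegral.smul_integral_comp_mul_left (a := 0) (b := 1) (fun u => b u p.2) p.1
    rw [← intervalIntegral.integral_of_le zero_le_one]
    simpa using this.symm
  simp_rw [h]
  refine measurable_fst.mul ?_
  have : StronglyMeasurable (fun q : (ℝ × Ω) × ℝ => b (q.1.1 * q.2) q.1.2) := by
    apply Measurable.stronglyMeasurable
    exact hb.comp ((measurable_fst.fst.mul measurable_snd).prodMk measurable_fst.snd)
  exact (this.integral_prod_right' (ν := volume.restrict (Set.Ioc (0:ℝ) 1))).measurable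

lemma sd_int_bound {Ω : Type*} (b : ℝ → Ω → ℝ) (L : ℝ) (hbd : ∀ u ω, |b u ω| ≤ L) (s : ℝ) (ω : Ω) :
    |∫ u in (0:ℝ)..s, b u ω| ≤ L * |s| := by
  simpa using intervalIntegral.norm_integral_le_of_norm_le_const (a := 0) (b := s)
    (f := fun u => b u ω) (C := L) (fun u _ => hbd u ω)

lemma sd_aem {Ω : Type*} (G : MeasurableSpace Ω) [m0 : MeasurableSpace Ω] (P : Measure Ω)
    [IsProbabilityMeasure P] (hG : G ≤ m0) (b : ℝ → Ω → ℝ)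
    (hb : Measurable fun p : ℝ × Ω => b p.1 p.2) (L : ℝ) (hbd : ∀ u ω, |b u ω| ≤ L)
    (s : ℝ) (hs : 0 ≤ s) (hbG : ∀ u, u ≤ s → Measurable[G] (b u)) :
    AEStronglyMeasurable[G] (fun ω => ∫ u in (0:ℝ)..s, b u ω) P := by
  set S : Ω → ℝ := fun ω => ∫ u in (0:ℝ)..s, b u ω with hS
  have hSm : Measurable S := (sd_meas_int b hb).comp (measurable_const.prodMk measurable_id)
  have hSb : ∀ ω, |S ω| ≤ L * |s| := sd_int_bound b L hbd s
  have hSi : Integrable S P := Integrable.of_bound hSm.aestronglyMeasurable (L * |s|)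
    (Filter.Eventually.of_forall hSb)
  have hL2 : MemLp S 2 P := MemLp.of_bound hSm.aestronglyMeasurable (L * |s|)
    (Filter.Eventually.of_forall hSb)
  have hW2 : MemLp (P[S | G]) 2 P := hL2.condExp (by norm_num)
  set Z : Ω → ℝ := S - P[S | G] with hZ
  have hZ2 : MemLp Z 2 P := hL2.sub hW2
  have hZi : Integrable Z P := hZ2.integrable (by norm_num)
  have hcz : P[Z | G] =ᵐ[P] 0 := by
    have h1 := condExp_sub hSi (integrable_condExp (f := S) (m := G) (μ := P)) G
    have h2 := condExp_condExp_of_le (f := S) (μ := P) (le_refl G) hG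
    filter_upwards [h1, h2] with ω a1 a2
    rw [hZ, a1]; simp [a2]
  have horth : ∀ g : Ω → ℝ, StronglyMeasurable[G] g → Integrable (g * Z) P →
      ∫ ω, g ω * Z ω ∂P = 0 := by
    intro g hg hgZ
    have h4 := condExp_mul_of_stronglyMeasurable_left hg hgZ hZi
    have h5 := integral_condExp hG (μ := P) (f := g * Z)
    rw [integral_congr_ae h4] at h5
    have h6 : ∫ ω, (g * P[Z | G]) ω ∂P = 0 := by
      rw [integral_congr_ae (g := 0)]
      · simp
      · filter_upwards [hcz] with ω hω
        simp [hω]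
    rw [h6] at h5
    exact h5.symm
  have hA : ∫ ω, (P[S | G]) ω * Z ω ∂P = 0 :=
    horth _ stronglyMeasurable_condExp (hW2.integrable_mul hZ2)
  have hB : ∫ ω, S ω * Z ω ∂P = 0 := by
    have e1 : ∀ ω, S ω * Z ω = ∫ u in (0:ℝ)..s, b u ω * Z ω := fun ω => by
      rw [intervalIntegral.integral_mul_const]
    simp_rw [e1]
    rw [← intervalIntegral_integral_swap (f := fun u ω => b u ω * Z ω)]
    · rw [intervalIntegral.integral_of_le hs]
      apply setIntegral_eq_zero_of_forall_eq_zero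
      intro u hu
      apply horth (b u) (hbG u hu.2).stronglyMeasurable
      exact hZi.bdd_mul (c := L) ((hbG u hu.2).mono hG le_rfl).aestronglyMeasurable
        (Filter.Eventually.of_forall (hbd u))
    · have : IsFiniteMeasure (volume.restrict (Set.uIoc 0 s)) :=
        ⟨by simp [Set.uIoc]⟩
      have : Integrable (fun p : ℝ × Ω => Z p.2)
          ((volume.restrict (Set.uIoc 0 s)).prod P) := hZi.comp_snd _
      exact this.bdd_mul (c := L) hb.aestronglyMeasurable
        (Filter.Eventually.of_forall fun p => hbd p.1 p.2)
  have hC : ∫ ω, Z ω ^ 2 ∂P = 0 := by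
    have : ∀ ω, Z ω ^ 2 = S ω * Z ω - (P[S | G]) ω * Z ω := fun ω => by
      simp only [hZ, Pi.sub_apply]; ring
    simp_rw [this]
    have e := integral_sub (hL2.integrable_mul hZ2) (hW2.integrable_mul hZ2)
    simp only [Pi.mul_apply] at e
    rw [e, hA, hB, sub_zero]
  rw [integral_eq_zero_iff_of_nonneg (fun ω => sq_nonneg _) hZ2.integrable_sq] at hC
  refine ⟨P[S | G], stronglyMeasurable_condExp, ?_⟩
  filter_upwards [hC] with ω hω
  have : Z ω = 0 := by simpa using hω
  simp only [hZ, Pi.sub_apply] at this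
  linarith

lemma sd_fubini {Ω : Type*} [m0 : MeasurableSpace Ω] (P : Measure Ω) [IsProbabilityMeasure P]
    (b : ℝ → Ω → ℝ) (hb : Measurable fun p : ℝ × Ω => b p.1 p.2) (L : ℝ)
    (hL : 0 ≤ L) (hbd : ∀ u ω, |b u ω| ≤ L) (Y : Ω → ℝ) (hY : Measurable Y) (K : ℝ)
    (hK : ∀ ω, |Y ω| ≤ K) (t : ℝ) (ht : 0 ≤ t) (n : ℕ) :
    ∫ ω, (∫ u in (0:ℝ)..t, b u ω) ^ (n + 1) * Y ω ∂P =
      ∫ r in (0:ℝ)..t, ((n : ℝ) + 1) *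
        ∫ ω, ((∫ u in (0:ℝ)..r, b u ω) ^ n * b r ω) * Y ω ∂P := by
  have h1 : ∀ ω, (∫ u in (0:ℝ)..t, b u ω) ^ (n + 1) * Y ω =
      ∫ r in (0:ℝ)..t, ((n : ℝ) + 1) * (((∫ u in (0:ℝ)..r, b u ω) ^ n * b r ω) * Y ω) := by
    intro ω
    rw [sd_pow_ftc (fun u => b u ω) (hb.comp (measurable_id.prodMk measurable_const)) L
      (fun u => hbd u ω), ← intervalIntegral.integral_mul_const]
    simp only [mul_assoc]
  simp_rw [h1]
  rw [← intervalIntegral_integral_swap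
    (f := fun r ω => ((n : ℝ) + 1) * (((∫ u in (0:ℝ)..r, b u ω) ^ n * b r ω) * Y ω))]
  · simp_rw [integral_const_mul]
  · have : IsFiniteMeasure (volume.restrict (Set.uIoc 0 t)) := ⟨by simp [Set.uIoc]⟩
    refine Integrable.of_bound (C := ((n : ℝ) + 1) * (((L * t) ^ n * L) * K)) ?_ ?_
    · apply Measurable.aestronglyMeasurable
      exact ((((sd_meas_int b hb).pow_const n).mul hb).mul (hY.comp measurable_snd)).const_mul _
    · have : ∀ᵐ p ∂((volume.restrict (Set.uIoc 0 t)).prod P), p.1 ∈ Set.uIoc 0 t := by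
        refine Measure.quasiMeasurePreserving_fst.ae (p := fun r => r ∈ Set.uIoc 0 t) ?_
        exact ae_restrict_mem measurableSet_uIoc
      filter_upwards [this] with p hp
      rw [Set.uIoc_of_le ht] at hp
      simp only [Function.uncurry, norm_mul, norm_pow, Real.norm_eq_abs]
      have e1 : |((n : ℝ) + 1)| = (n : ℝ) + 1 := abs_of_nonneg (by positivity)
      rw [e1]
      have e2 : |∫ u in (0:ℝ)..p.1, b u p.2| ≤ L * t := by
        refine (sd_int_bound b L hbd p.1 p.2).trans ?_
        rw [abs_of_pos hp.1]
        exact mul_le_mul_of_nonneg_left hp.2 hL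
      have := hbd p.1 p.2
      have := hK p.2
      gcongr

lemma sd_moment {Ω : Type*} [m0 : MeasurableSpace Ω] (P : Measure Ω) [IsProbabilityMeasure P]
    (b : ℝ → Ω → ℝ) (hb : Measurable fun p : ℝ × Ω => b p.1 p.2) (L : ℝ)
    (hL : 0 ≤ L) (hbd : ∀ u ω, |b u ω| ≤ L) (φ : ℝ → ℝ)
    (hanti : Antitone φ) (hφ0 : ∀ u, 0 ≤ φ u) (hsum : Summable fun l : ℕ => φ l)
    (hcov : ∀ s r, 0 ≤ s → s ≤ r → ∀ n : ℕ,
      |∫ ω, ((∫ u in (0:ℝ)..s, b u ω) ^ n * b s ω) * b r ω ∂P| ≤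
        2 * L * φ (r - s) * ∫ ω, |(∫ u in (0:ℝ)..s, b u ω) ^ n * b s ω| ∂P) :
    ∀ (M : ℕ) (t : ℝ), 0 ≤ t → ∫ ω, (∫ u in (0:ℝ)..t, b u ω) ^ (2 * M) ∂P ≤
      (2 * M).factorial * (2 * L ^ 2 * ∑' l : ℕ, φ l) ^ M * t ^ M := by
  have hSm : ∀ s, Measurable fun ω => ∫ u in (0:ℝ)..s, b u ω := fun s =>
    (sd_meas_int b hb).comp (measurable_const.prodMk measurable_id)
  have hbm : ∀ s, Measurable (b s) := fun s => hb.comp (measurable_const.prodMk measurable_id)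
  have hΦ0 : 0 ≤ ∑' l : ℕ, φ l := tsum_nonneg fun l => hφ0 l
  have hφint : ∀ r, 0 ≤ r → IntervalIntegrable (fun s => φ (r - s)) volume 0 r ∧
      ∫ s in (0:ℝ)..r, φ (r - s) ≤ ∑' l : ℕ, φ l := by
    intro r hr
    refine ⟨?_, ?_⟩
    · have : Monotone fun s => φ (r - s) := fun x y hxy => hanti (by linarith)
      exact this.intervalIntegrable
    · rw [intervalIntegral.integral_comp_sub_left (fun u => φ u) r]
      simp only [sub_self, sub_zero]
      rw [intervalIntegral.integral_of_le hr]
      refine le_trans ?_ ((hanti.antitoneOn _).integral_le_tsum hsum (fun t _ => hφ0 t))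
      refine setIntegral_mono_set ?_ (Filter.Eventually.of_forall fun u => hφ0 u)
        (Filter.Eventually.of_forall Set.Ioc_subset_Ioi_self)
      exact (hanti.antitoneOn _).integrableOn_Ioi_zero_of_summable hsum (fun t _ => hφ0 t)
  intro M
  induction M with
  | zero => intro t ht; simp
  | succ M ih =>
    intro t ht
    set K : ℝ := (2 * M).factorial * (2 * L ^ 2 * ∑' l : ℕ, φ l) ^ M with hKdef
    have hK0 : 0 ≤ K := by positivity
    -- inner bound
    have hin : ∀ r, 0 ≤ r →
        |∫ ω, (∫ u in (0:ℝ)..r, b u ω) ^ (2 * M + 1) * b r ω ∂P| ≤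
          (2 * M + 1) * (2 * L ^ 2 * (K * r ^ M)) * ∑' l : ℕ, φ l := by
      intro r hr
      rw [sd_fubini P b hb L hL hbd (b r) (hbm r) L (hbd r) r hr (2 * M)]
      rw [← Real.norm_eq_abs]
      have hpt : ∀ s ∈ Set.Ioc 0 r, ‖(((2 * M : ℕ) : ℝ) + 1) *
          ∫ ω, ((∫ u in (0:ℝ)..s, b u ω) ^ (2 * M) * b s ω) * b r ω ∂P‖ ≤
          (2 * M + 1) * (2 * L ^ 2 * (K * r ^ M)) * φ (r - s) := by
        intro s hs
        rw [norm_mul, Real.norm_eq_abs, Real.norm_eq_abs, abs_of_nonneg (by positivity)]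
        push_cast
        rw [mul_assoc]
        refine mul_le_mul_of_nonneg_left ?_ (by positivity)
        refine (hcov s r hs.1.le hs.2 (2 * M)).trans ?_
        have hmom : ∫ ω, |(∫ u in (0:ℝ)..s, b u ω) ^ (2 * M) * b s ω| ∂P ≤ K * r ^ M * L := by
          calc _ ≤ ∫ ω, (∫ u in (0:ℝ)..s, b u ω) ^ (2 * M) * L ∂P := by
                refine integral_mono_of_nonneg (Filter.Eventually.of_forall fun _ => abs_nonneg _)
                  ?_ (Filter.Eventually.of_forall fun ω => ?_)
                · refine Integrable.mul_const ?_ _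
                  refine Integrable.of_bound ((hSm s).pow_const _).aestronglyMeasurable
                    ((L * |s|) ^ (2 * M)) (Filter.Eventually.of_forall fun ω => ?_)
                  rw [norm_pow]
                  exact pow_le_pow_left₀ (norm_nonneg _) (sd_int_bound b L hbd s ω) _
                · have he : 0 ≤ (∫ u in (0:ℝ)..s, b u ω) ^ (2 * M) :=
                    (even_two_mul M).pow_nonneg _
                  simp only [abs_mul, abs_of_nonneg he]
                  exact mul_le_mul_of_nonneg_left (hbd s ω) he
            _ = (∫ ω, (∫ u in (0:ℝ)..s, b u ω) ^ (2 * M) ∂P) * L := integral_mul_const _ _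
            _ ≤ K * r ^ M * L := by
                refine mul_le_mul_of_nonneg_right ((ih s hs.1.le).trans ?_) hL
                refine mul_le_mul_of_nonneg_left ?_ hK0
                exact pow_le_pow_left₀ hs.1.le hs.2 _
        have := hφ0 (r - s)
        calc _ ≤ 2 * L * φ (r - s) * (K * r ^ M * L) :=
              mul_le_mul_of_nonneg_left hmom (by positivity)
          _ = _ := by ring
      refine (intervalIntegral.norm_integral_le_of_norm_le hr
        (Filter.Eventually.of_forall hpt) ((hφint r hr).1.const_mul _)).trans ?_
      rw [intervalIntegral.integral_const_mul]
      exact mul_le_mul_of_nonneg_left (hφint r hr).2 (by positivity)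
    have h1 := sd_fubini P b hb L hL hbd (fun _ => 1) measurable_const 1 (by simp) t ht (2 * M + 1)
    simp only [mul_one] at h1
    have e : 2 * (M + 1) = 2 * M + 1 + 1 := by ring
    rw [e, h1]
    refine (le_abs_self _).trans ?_
    rw [← Real.norm_eq_abs]
    refine (intervalIntegral.norm_integral_le_of_norm_le_const (C := (2 * M + 2) *
      ((2 * M + 1) * (2 * L ^ 2 * (K * t ^ M)) * ∑' l : ℕ, φ l)) ?_).trans ?_
    · intro r hr
      rw [Set.uIoc_of_le ht] at hr
      rw [norm_mul, Real.norm_eq_abs, Real.norm_eq_abs, abs_of_nonneg (by positivity)]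
      push_cast
      have hrt : r ^ M ≤ t ^ M := pow_le_pow_left₀ hr.1.le hr.2 _
      have h2 : (2 * (M:ℝ) + 1) * (2 * L ^ 2 * (K * r ^ M)) * ∑' l : ℕ, φ l ≤
          (2 * (M:ℝ) + 1) * (2 * L ^ 2 * (K * t ^ M)) * ∑' l : ℕ, φ l := by gcongr
      have h3 := (hin r hr.1.le).trans h2
      have h4 : (2 * (M:ℝ) + 1 + 1) = 2 * M + 2 := by ring
      rw [h4]
      exact mul_le_mul_of_nonneg_left h3 (by positivity)
    · rw [sub_zero, abs_of_nonneg ht]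
      apply le_of_eq
      rw [Nat.factorial_succ, Nat.factorial_succ, hKdef]
      push_cast
      ring

lemma sd_phiDep_set {Ω : Type*} {m0 : MeasurableSpace Ω} (P : Measure Ω) [IsProbabilityMeasure P]
    (G H : MeasurableSpace Ω) (r : ℝ)
    (hr : ∃ Γ Δ : Set Ω, MeasurableSet[G] Γ ∧ MeasurableSet[H] Δ ∧ P Γ ≠ 0 ∧
    r = |(P (Γ ∩ Δ)).toReal / (P Γ).toReal - (P Δ).toReal|) : r ≤ 1 := by
  obtain ⟨Γ, Δ, -, -, h0, rfl⟩ := hr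
  have h1 : (P (Γ ∩ Δ)).toReal / (P Γ).toReal ≤ 1 :=
    div_le_one_of_le₀ (measureReal_mono Set.inter_subset_left) ENNReal.toReal_nonneg
  have h2 : 0 ≤ (P (Γ ∩ Δ)).toReal / (P Γ).toReal := by positivity
  have h3 : (P Δ).toReal ≤ 1 := measureReal_le_one
  have h4 : 0 ≤ (P Δ).toReal := ENNReal.toReal_nonneg
  exact abs_le.2 ⟨by linarith, by linarith⟩

lemma sd_phiDep_bdd {Ω : Type*} {m0 : MeasurableSpace Ω} (P : Measure Ω) [IsProbabilityMeasure P]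
    (G H : MeasurableSpace Ω) :
    BddAbove {r : ℝ | ∃ Γ Δ : Set Ω, MeasurableSet[G] Γ ∧ MeasurableSet[H] Δ ∧ P Γ ≠ 0 ∧
    r = |(P (Γ ∩ Δ)).toReal / (P Γ).toReal - (P Δ).toReal|} :=
  ⟨1, fun r hr => sd_phiDep_set P G H r hr⟩

lemma sd_phiDep_nonneg {Ω : Type*} {m0 : MeasurableSpace Ω} (P : Measure Ω)
    (G H : MeasurableSpace Ω) : 0 ≤ phiDep P G H := by
  apply Real.sSup_nonneg
  rintro r ⟨Γ, Δ, -, -, -, rfl⟩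
  exact abs_nonneg _

lemma sd_phiDep_le_one {Ω : Type*} {m0 : MeasurableSpace Ω} (P : Measure Ω)
    [IsProbabilityMeasure P] (G H : MeasurableSpace Ω) : phiDep P G H ≤ 1 :=
  Real.sSup_le (fun r hr => sd_phiDep_set P G H r hr) zero_le_one

lemma sd_phiDep_mono {Ω : Type*} {m0 : MeasurableSpace Ω} (P : Measure Ω)
    [IsProbabilityMeasure P] (G H H' : MeasurableSpace Ω) (h : H ≤ H') :
    phiDep P G H ≤ phiDep P G H' := by
  apply Real.sSup_le _ (sd_phiDep_nonneg P G H')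
  rintro r ⟨Γ, Δ, h1, h2, h3, h4⟩
  exact le_csSup (sd_phiDep_bdd P G H') ⟨Γ, Δ, h1, h Δ h2, h3, h4⟩

lemma sd_phiMix_bdd {Ω : Type*} {m0 : MeasurableSpace Ω} (P : Measure Ω)
    [IsProbabilityMeasure P] (F : ℝ → ℝ → MeasurableSpace Ω) (u : ℝ) :
    BddAbove (Set.range fun t : ℝ => phiDep P (Fpast F t) (Ffut F (t + u))) :=
  ⟨1, by rintro _ ⟨t, rfl⟩; exact sd_phiDep_le_one P _ _⟩

lemma sd_phiMix_nonneg {Ω : Type*} {m0 : MeasurableSpace Ω} (P : Measure Ω)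
    (F : ℝ → ℝ → MeasurableSpace Ω) (u : ℝ) : 0 ≤ phiMix P F u :=
  Real.iSup_nonneg fun _ => sd_phiDep_nonneg P _ _

lemma sd_phiMix_anti {Ω : Type*} {m0 : MeasurableSpace Ω} (P : Measure Ω)
    [IsProbabilityMeasure P] (F : ℝ → ℝ → MeasurableSpace Ω)
    (hFmono : ∀ s' s t t' : ℝ, s' ≤ s → s ≤ t → t ≤ t' → F s t ≤ F s' t') :
    Antitone (phiMix P F) := by
  intro u v huv
  refine ciSup_mono (sd_phiMix_bdd P F u) fun t => sd_phiDep_mono P _ _ _ ?_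
  refine iSup₂_le fun w hw => ?_
  exact (hFmono (t + u) (t + v) w w (by linarith) hw le_rfl).trans
    (le_iSup₂_of_le (f := fun (w : ℝ) (_ : t + u ≤ w) => F (t + u) w) w (by linarith) le_rfl)

lemma sd_phi_ineq {Ω : Type*} {m0 : MeasurableSpace Ω} (P : Measure Ω)
    [IsProbabilityMeasure P] (G H : MeasurableSpace Ω) (c : ℝ) (hc : phiDep P G H ≤ c)
    (Γ Δ : Set Ω) (hΓ : MeasurableSet[G] Γ) (hΔ : MeasurableSet[H] Δ) :
    P.real (Γ ∩ Δ) ≤ P.real Γ * P.real Δ + c * P.real Γ := by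
  by_cases h0 : P Γ = 0
  · have h1 : P (Γ ∩ Δ) = 0 := measure_mono_null Set.inter_subset_left h0
    simp [Measure.real, h0, h1]
  · have h1 : |P.real (Γ ∩ Δ) / P.real Γ - P.real Δ| ≤ c :=
      (le_csSup (sd_phiDep_bdd P G H) ⟨Γ, Δ, hΓ, hΔ, h0, rfl⟩).trans hc
    have hpos : 0 < P.real Γ := ENNReal.toReal_pos h0 (measure_ne_top _ _)
    have h2 : P.real (Γ ∩ Δ) / P.real Γ ≤ P.real Δ + c := by
      have := (abs_le.1 h1).2; linarith
    rw [div_le_iff₀ hpos] at h2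
    linarith

/-- Lemma 3.5: assuming `Σ_{l=0}^∞ φ(l) < ∞`, for all `t ≥ 0`, `x` and
integers `M ≥ 1`, `E|∫_0^t B(x,ξ(u)) du|^{2M} ≤ C₁(M) t^M` with
`C₁(M) = (2d)^{2M+1} (2M)! (2L(1+Σ_{l=0}^∞ φ(l)))^{2M}`. -/
theorem strong_diffusion_stmt7
    {Ω : Type*} [m0 : MeasurableSpace Ω] (P : Measure Ω) [IsProbabilityMeasure P]
    {d ν : ℕ}
    (F : ℝ → ℝ → MeasurableSpace Ω)
    (hFle : ∀ s t : ℝ, F s t ≤ m0)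
    (hFmono : ∀ s' s t t' : ℝ, s' ≤ s → s ≤ t → t ≤ t' → F s t ≤ F s' t')
    (ξ : ℝ → Ω → EuclideanSpace ℝ (Fin ν))
    (hξmeas : Measurable fun p : ℝ × Ω => ξ p.1 p.2)
    (hξadapt : ∀ t : ℝ, Measurable[F t t] (ξ t))
    (hξstat : ∀ h : ℝ, Measure.map (fun ω => fun t : ℝ => ξ (t + h) ω) P =
      Measure.map (fun ω => fun t : ℝ => ξ t ω) P)
    (B : EuclideanSpace ℝ (Fin d) → EuclideanSpace ℝ (Fin ν) → EuclideanSpace ℝ (Fin d))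
    (hBmeas : ∀ x, Measurable (B x))
    (L : ℝ) (hL : 1 ≤ L)
    (hBbd : ∀ x y, ‖B x y‖ ≤ L)
    (hBzero : ∀ x s, ∫ ω, B x (ξ s ω) ∂P = 0)
    (hφsum : Summable fun l : ℕ => phiMix P F l) :
    ∀ (t : ℝ) (x : EuclideanSpace ℝ (Fin d)) (M : ℕ), 0 ≤ t → 1 ≤ M →
      ∫ ω, ‖∫ u in (0:ℝ)..t, B x (ξ u ω)‖ ^ (2 * M) ∂P ≤
        ((2 * d : ℝ) ^ (2 * M + 1) * ((2 * M).factorial : ℝ) *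
            (2 * L * (1 + ∑' l : ℕ, phiMix P F l)) ^ (2 * M)) * t ^ M := by
  intro t x M ht hM
  have hL0 : 0 ≤ L := by linarith
  set Φ : ℝ := ∑' l : ℕ, phiMix P F l with hΦ
  have hΦ0 : 0 ≤ Φ := tsum_nonneg fun l => sd_phiMix_nonneg P F l
  have hpast : ∀ s, Fpast F s ≤ m0 := fun s => iSup₂_le fun _ _ => hFle _ _
  have hfut : ∀ s, Ffut F s ≤ m0 := fun s => iSup₂_le fun _ _ => hFle _ _
  -- measurability and integrability of the vector process
  have hBm : Measurable fun p : ℝ × Ω => B x (ξ p.1 p.2) := (hBmeas x).comp hξmeas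
  have hBs : ∀ s, Measurable fun ω => B x (ξ s ω) := fun s =>
    hBm.comp (measurable_const.prodMk measurable_id)
  have hBi : ∀ s, Integrable (fun ω => B x (ξ s ω)) P := fun s =>
    Integrable.of_bound (hBs s).aestronglyMeasurable L (Filter.Eventually.of_forall fun ω => hBbd _ _)
  have hBu : ∀ ω, IntervalIntegrable (fun u => B x (ξ u ω)) volume 0 t := fun ω =>
    (intervalIntegrable_const (c := L)).mono_fun
      (hBm.comp (measurable_id.prodMk measurable_const)).aestronglyMeasurable
      (Filter.Eventually.of_forall fun u => (hBbd _ _).trans (le_abs_self L))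
  -- coordinates
  have hcm : ∀ i : Fin d, Measurable fun v : EuclideanSpace ℝ (Fin d) => v i := fun i =>
    (EuclideanSpace.proj (𝕜 := ℝ) i).continuous.measurable
  have hcoord : ∀ i : Fin d, ∀ ω, (∫ u in (0:ℝ)..t, B x (ξ u ω)) i =
      ∫ u in (0:ℝ)..t, (B x (ξ u ω)) i := fun i ω =>
    ((EuclideanSpace.proj (𝕜 := ℝ) i).intervalIntegral_comp_comm (hBu ω)).symm
  have hbm : ∀ i : Fin d, Measurable fun p : ℝ × Ω => (B x (ξ p.1 p.2)) i := fun i =>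
    (hcm i).comp hBm
  have hbb : ∀ i : Fin d, ∀ u ω, |(B x (ξ u ω)) i| ≤ L := fun i u ω =>
    (PiLp.norm_apply_le _ i).trans (hBbd _ _)
  have hmom : ∀ i : Fin d, ∫ ω, (∫ u in (0:ℝ)..t, (B x (ξ u ω)) i) ^ (2 * M) ∂P ≤
      (2 * M).factorial * (2 * L ^ 2 * Φ) ^ M * t ^ M := by
    intro i
    refine sd_moment P (fun u ω => (B x (ξ u ω)) i) (hbm i) L hL0 (hbb i) (phiMix P F)
      (sd_phiMix_anti P F hFmono) (sd_phiMix_nonneg P F) hφsum ?_ M t ht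
    intro s r hs hsr n
    have hbG : ∀ u, u ≤ s → Measurable[Fpast F s] fun ω => (B x (ξ u ω)) i := fun u hu =>
      ((hcm i).comp ((hBmeas x).comp (hξadapt u))).mono
        ((hFmono u u u s le_rfl le_rfl hu).trans
          (le_iSup₂_of_le (f := fun (w : ℝ) (_ : w ≤ s) => F w s) u hu le_rfl)) le_rfl
    have hrH : Measurable[Ffut F r] fun ω => (B x (ξ r ω)) i :=
      ((hcm i).comp ((hBmeas x).comp (hξadapt r))).mono
        (le_iSup₂_of_le (f := fun (w : ℝ) (_ : r ≤ w) => F r w) r le_rfl le_rfl) le_rfl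
    have hc : phiDep P (Fpast F s) (Ffut F r) ≤ phiMix P F (r - s) := by
      have := le_ciSup (sd_phiMix_bdd P F (r - s)) s
      simp only [add_sub_cancel] at this
      exact this
    have hSae := sd_aem (Fpast F s) P (hpast s) (fun u ω => (B x (ξ u ω)) i) (hbm i) L (hbb i)
      s hs hbG
    have hSm : Measurable fun ω => ∫ u in (0:ℝ)..s, (B x (ξ u ω)) i :=
      (sd_meas_int (fun u ω => (B x (ξ u ω)) i) (hbm i)).comp
        (measurable_const.prodMk measurable_id)
    refine sd_cov (Fpast F s) (Ffut F r) P (hpast s) (hfut r) (phiMix P F (r - s))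
      (sd_phi_ineq P _ _ _ hc) (fun ω => (B x (ξ r ω)) i) hrH L hL0 (hbb i r) ?_
      (fun ω => (∫ u in (0:ℝ)..s, (B x (ξ u ω)) i) ^ n * (B x (ξ s ω)) i) ?_ ?_
    · have h1 := (EuclideanSpace.proj (𝕜 := ℝ) i).integral_comp_comm (hBi r)
      rw [hBzero x r] at h1
      simpa using h1
    · exact (hSae.pow n).mul (hbG s le_rfl).stronglyMeasurable.aestronglyMeasurable
    · refine Integrable.of_bound ((hSm.pow_const n).mul
        ((hcm i).comp (hBs s))).aestronglyMeasurable ((L * |s|) ^ n * L)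
        (Filter.Eventually.of_forall fun ω => ?_)
      rw [norm_mul, norm_pow]
      exact mul_le_mul (pow_le_pow_left₀ (norm_nonneg _)
        (sd_int_bound (fun u ω => (B x (ξ u ω)) i) L (hbb i) s ω) _) (hbb i s ω)
        (norm_nonneg _) (by positivity)
  -- combine the coordinates
  obtain ⟨m, rfl⟩ : ∃ m, M = m + 1 := ⟨M - 1, by omega⟩
  have hnorm : ∀ ω, ‖∫ u in (0:ℝ)..t, B x (ξ u ω)‖ ^ (2 * (m + 1)) ≤
      (d : ℝ) ^ m * ∑ i : Fin d, (∫ u in (0:ℝ)..t, (B x (ξ u ω)) i) ^ (2 * (m + 1)) := by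
    intro ω
    rw [pow_mul, EuclideanSpace.real_norm_sq_eq]
    have := pow_sum_le_card_mul_sum_pow (s := Finset.univ)
      (f := fun i : Fin d => (∫ u in (0:ℝ)..t, B x (ξ u ω)) i ^ 2) (fun i _ => sq_nonneg _) m
    simpa only [hcoord, ← pow_mul, Finset.card_univ, Fintype.card_fin] using this
  have hint : ∀ i : Fin d, Integrable
      (fun ω => (∫ u in (0:ℝ)..t, (B x (ξ u ω)) i) ^ (2 * (m + 1))) P := by
    intro i
    have hSm : Measurable fun ω => ∫ u in (0:ℝ)..t, (B x (ξ u ω)) i :=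
      (sd_meas_int (fun u ω => (B x (ξ u ω)) i) (hbm i)).comp
        (measurable_const.prodMk measurable_id)
    refine Integrable.of_bound (hSm.pow_const _).aestronglyMeasurable
      ((L * |t|) ^ (2 * (m + 1))) (Filter.Eventually.of_forall fun ω => ?_)
    rw [norm_pow]
    exact pow_le_pow_left₀ (norm_nonneg _)
      (sd_int_bound (fun u ω => (B x (ξ u ω)) i) L (hbb i) t ω) _
  have hstep : ∫ ω, ‖∫ u in (0:ℝ)..t, B x (ξ u ω)‖ ^ (2 * (m + 1)) ∂P ≤
      (d : ℝ) ^ m * (d * ((2 * (m + 1)).factorial * (2 * L ^ 2 * Φ) ^ (m + 1) * t ^ (m + 1))) := by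
    calc _ ≤ ∫ ω, (d : ℝ) ^ m *
          ∑ i : Fin d, (∫ u in (0:ℝ)..t, (B x (ξ u ω)) i) ^ (2 * (m + 1)) ∂P :=
          integral_mono_of_nonneg (Filter.Eventually.of_forall fun ω => by positivity)
            ((integrable_finsetSum _ fun i _ => hint i).const_mul _)
            (Filter.Eventually.of_forall hnorm)
      _ = (d : ℝ) ^ m *
          ∑ i : Fin d, ∫ ω, (∫ u in (0:ℝ)..t, (B x (ξ u ω)) i) ^ (2 * (m + 1)) ∂P := by
          rw [integral_const_mul, integral_finsetSum _ fun i _ => hint i]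
      _ ≤ _ := by
          refine mul_le_mul_of_nonneg_left ?_ (by positivity)
          refine (Finset.sum_le_sum fun i _ => hmom i).trans ?_
          simp
  refine hstep.trans ?_
  have hd : (d : ℝ) ^ (m + 1) ≤ (2 * d : ℝ) ^ (2 * (m + 1) + 1) := by
    rcases Nat.eq_zero_or_pos d with h | h
    · subst h; simp
    · have h1 : (1 : ℝ) ≤ d := by exact_mod_cast h
      calc (d : ℝ) ^ (m + 1) ≤ (2 * d : ℝ) ^ (m + 1) := by gcongr; linarith
        _ ≤ _ := pow_le_pow_right₀ (by linarith) (by omega)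
  have hb2 : (2 * L ^ 2 * Φ) ^ (m + 1) ≤ (2 * L * (1 + Φ)) ^ (2 * (m + 1)) := by
    rw [pow_mul]
    refine pow_le_pow_left₀ (by positivity) ?_ _
    nlinarith [sq_nonneg L, mul_nonneg (sq_nonneg L) hΦ0, mul_nonneg (sq_nonneg L) (sq_nonneg Φ)]
  calc _ = (d : ℝ) ^ (m + 1) * ((2 * (m + 1)).factorial : ℝ) * (2 * L ^ 2 * Φ) ^ (m + 1)
        * t ^ (m + 1) := by ring
    _ ≤ _ := by gcongr

end
end
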